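/- Let m ≥ 1 be a fixed integer and let e = exp(1). The function f(c) = (ec + 1)^m · (1 − 1/(ec + 1))^c is monotonically increasing in the real variable c on the interval [1, ∞). -/

import Mathlib

open Real in
/-- The logarithm of `c ↦ (ac+1)^m (1 - 1/(ac+1))^c` is increasing on `[1, ∞)` for `a ≥ 1`. -/
theorem monotoneOn_log_threshold_function {a : ℝ} (ha : 1 ≤ a) {m : ℕ} (hm : 1 ≤ m) :
    MonotoneOn (fun c : ℝ => m * log (a * c + 1) + c * (log (a * c) - log (a * c + 1)))
      (Set.Ici (1 : ℝ)) := by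
  have hderiv (c : ℝ) (hc : 1 ≤ c) :
      HasDerivAt (fun c : ℝ => m * log (a * c + 1) + c * (log (a * c) - log (a * c + 1)))
        (m * (a / (a * c + 1)) + (1 * (log (a * c) - log (a * c + 1)) +
          c * (a / (a * c) - a / (a * c + 1)))) c := by
    have hac : 0 < a * c := by positivity
    have hlin : HasDerivAt (fun c : ℝ => a * c) a c := by
      simpa using (hasDerivAt_id c).const_mul a
    have hlog := (hlin.add_const 1).log (by positivity)
    exact (hlog.const_mul (m : ℝ)).add ((hasDerivAt_id c).mul ((hlin.log hac.ne').sub hlog))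
  refine monotoneOn_of_deriv_nonneg (convex_Ici 1)
    (fun c hc => (hderiv c hc).continuousAt.continuousWithinAt)
    (fun c hc => (hderiv c (interior_subset hc)).differentiableAt.differentiableWithinAt)
    fun c hc => ?_
  have hc1 : 1 ≤ c := interior_subset hc
  rw [(hderiv c hc1).deriv]
  have hac : 1 ≤ a * c := one_le_mul_of_one_le_of_one_le ha hc1
  have hlog : log (a * c + 1) - log (a * c) ≤ 1 / (a * c) := by
    rw [← log_div (by positivity) (by positivity)]
    refine (log_le_sub_one_of_pos (by positivity)).trans_eq ?_
    field_simp
    ring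
  have hm' : (1 : ℝ) ≤ m := by exact_mod_cast hm
  have hfirst : a / (a * c + 1) ≤ m * (a / (a * c + 1)) :=
    le_mul_of_one_le_left (by positivity) hm'
  have hmain : 1 / (a * c) ≤ a / (a * c + 1) + c * (a / (a * c) - a / (a * c + 1)) := by
    have hrhs : a / (a * c + 1) + c * (a / (a * c) - a / (a * c + 1)) =
        (a + 1) / (a * c + 1) := by
      field_simp
      ring
    rw [hrhs, div_le_div_iff₀ (by positivity) (by positivity)]
    nlinarith
  linarith

/-- For fixed `m ≥ 1`, the function `c ↦ (ec+1)^m (1 - 1/(ec+1))^c` is monotonically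
increasing on `[1, ∞)`. -/
theorem threshold_function_monotone (m : ℕ) (hm : 1 ≤ m) :
    MonotoneOn
      (fun c : ℝ => (Real.exp 1 * c + 1) ^ m * (1 - 1 / (Real.exp 1 * c + 1)) ^ c)
      (Set.Ici (1 : ℝ)) := by
  have he : 1 ≤ Real.exp 1 := Real.one_le_exp zero_le_one
  refine (Real.exp_monotone.comp_monotoneOn
    (monotoneOn_log_threshold_function he hm)).congr fun c hc => ?_
  have hc0 : 0 < c := zero_lt_one.trans_le hc
  have hx : 0 < Real.exp 1 * c := by positivity
  have hbase : 1 - 1 / (Real.exp 1 * c + 1) = Real.exp 1 * c / (Real.exp 1 * c + 1) := by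
    field_simp
    ring
  simp only [Function.comp_apply]
  rw [hbase, Real.rpow_def_of_pos (by positivity), Real.log_div (by positivity) (by positivity),
    Real.exp_add, Real.exp_nat_mul, Real.exp_log (by positivity), mul_comm c]
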